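/- arXiv:1705.04970 — 2 statements merged into one kernel-verified Lean document; each statement's English description precedes it below -/
import Mathlib

section
/- Let x ∈ {0,1}^n, w ∈ ℝ_{≥0}^m, and let j1 ≠ j2 satisfy x_{j1} = x_{j2} = 0. Then Δẑ_{j1,j2}(x,w) = Δẑ_{j1}↑(x,w) + Δẑ_{j2}↑(x,w) + Σ_{i ∈ M_−(x) ∩ S_{j1} ∩ S_{j2}} w_i, where M_−(x) = {i ∈ M : Σ_{j∈N} a_{ij} x_j = b_i − 1}. -/
open Finset

/-- Number of selected columns covering element `i`: `Σ_{j∈N} a_{ij} x_j`,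
where column `j` corresponds to the subset `S j ⊆ M`. -/
def cover {m n : ℕ} (S : Fin n → Finset (Fin m)) (x : Fin n → ℕ) (i : Fin m) : ℕ :=
  ∑ j, if i ∈ S j then x j else 0

/-- Penalized objective
`ẑ(x,w) = Σ_j c_j x_j + Σ_i w_i · max{b_i − Σ_j a_{ij} x_j, 0}`. -/
noncomputable def zhat {m n : ℕ} (c : Fin n → ℝ) (S : Fin n → Finset (Fin m))
    (b : Fin m → ℕ) (w : Fin m → ℝ) (x : Fin n → ℕ) : ℝ :=
  ∑ j, c j * (x j : ℝ) + ∑ i, w i * max ((b i : ℝ) - (cover S x i : ℝ)) 0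

/-- Flip the `j`-th coordinate of a 0-1 vector. -/
def flipAt {n : ℕ} (x : Fin n → ℕ) (j : Fin n) : Fin n → ℕ :=
  fun j' => if j' = j then 1 - x j' else x j'

theorem flipAt_apply_of_eq_zero {n : ℕ} {x : Fin n → ℕ} {j : Fin n} (hj : x j = 0) (k : Fin n) :
    flipAt x j k = x k + if k = j then 1 else 0 := by
  unfold flipAt
  split_ifs with h
  · simp [h, hj]
  · simp

theorem cover_flipAt_of_eq_zero {m n : ℕ} (S : Fin n → Finset (Fin m)) {x : Fin n → ℕ}
    {j : Fin n} (hj : x j = 0) (i : Fin m) :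
    cover S (flipAt x j) i = cover S x i + if i ∈ S j then 1 else 0 := by
  have h (k : Fin n) : (if i ∈ S k then flipAt x j k else 0)
      = (if i ∈ S k then x k else 0) + if k = j then (if i ∈ S j then 1 else 0) else 0 := by
    rw [flipAt_apply_of_eq_zero hj]
    by_cases hk : k = j
    · subst hk
      split_ifs <;> simp
    · simp [hk]
  simp [cover, h, sum_add_distrib]

theorem sum_cost_flipAt_of_eq_zero {n : ℕ} (c : Fin n → ℝ) {x : Fin n → ℕ} {j : Fin n}
    (hj : x j = 0) :
    ∑ k, c k * (flipAt x j k : ℝ) = ∑ k, c k * (x k : ℝ) + c j := by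
  simp [flipAt_apply_of_eq_zero hj, mul_add, sum_add_distrib]

/-- Second difference of the truncated shortfall when the coverage grows by `p` and by `q`. -/
theorem shortfall_second_difference (b k : ℕ) (p q : Prop) [Decidable p] [Decidable q] :
    max ((b : ℝ) - ((k + (if p then 1 else 0) + (if q then 1 else 0) : ℕ) : ℝ)) 0
        + max ((b : ℝ) - (k : ℝ)) 0
      = max ((b : ℝ) - ((k + if p then 1 else 0 : ℕ) : ℝ)) 0
        + max ((b : ℝ) - ((k + if q then 1 else 0 : ℕ) : ℝ)) 0
        + if (p ∧ q) ∧ k + 1 = b then 1 else 0 := by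
  have h (r : ℕ) : max ((b : ℝ) - (r : ℝ)) 0 = ((b - r : ℕ) : ℝ) := by
    rcases le_total r b with hr | hr
    · rw [Nat.cast_sub hr, max_eq_left (sub_nonneg.2 (Nat.cast_le.2 hr))]
    · rw [Nat.sub_eq_zero_of_le hr, Nat.cast_zero,
        max_eq_right (sub_nonpos.2 (Nat.cast_le.2 hr))]
  simp only [h]
  norm_cast
  by_cases hp : p <;> by_cases hq : q <;> simp only [hp, hq] <;> split_ifs <;> grind

/-- for a 0-1 vector `x` with `x j1 = x j2 = 0` (`j1 ≠ j2`)
and nonnegative penalty weights `w`,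
`Δẑ_{j1,j2}(x,w) = Δẑ_{j1}↑(x,w) + Δẑ_{j2}↑(x,w) + Σ_{i ∈ M_−(x) ∩ S_{j1} ∩ S_{j2}} w_i`,
where `M_−(x) = {i : Σ_j a_{ij} x_j = b_i − 1}`. -/
theorem delta_two_flip_both_zero {m n : ℕ} (c : Fin n → ℝ) (S : Fin n → Finset (Fin m))
    (b : Fin m → ℕ) (w : Fin m → ℝ) (x : Fin n → ℕ)
    (hc : ∀ j, 0 < c j) (hw : ∀ i, 0 ≤ w i) (hx : ∀ j, x j ≤ 1)
    (j1 j2 : Fin n) (hne : j1 ≠ j2) (hj1 : x j1 = 0) (hj2 : x j2 = 0) :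
    zhat c S b w (flipAt (flipAt x j1) j2) - zhat c S b w x
      = (zhat c S b w (flipAt x j1) - zhat c S b w x)
        + (zhat c S b w (flipAt x j2) - zhat c S b w x)
        + ∑ i ∈ (S j1 ∩ S j2).filter (fun i => cover S x i + 1 = b i), w i := by
  have hj2' : flipAt x j1 j2 = 0 := by simp [flipAt_apply_of_eq_zero hj1, hj2, hne.symm]
  have hfilter : ∑ i ∈ (S j1 ∩ S j2).filter (fun i => cover S x i + 1 = b i), w i
      = ∑ i, w i * if (i ∈ S j1 ∧ i ∈ S j2) ∧ cover S x i + 1 = b i then 1 else 0 := by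
    simp only [mul_ite, mul_one, mul_zero]
    rw [← sum_filter]
    congr 1
    ext i
    simp
  have hpen := sum_congr (rfl : (univ : Finset (Fin m)) = univ) fun i _ =>
    congrArg (w i * ·) (shortfall_second_difference (b i) (cover S x i) (i ∈ S j1) (i ∈ S j2))
  simp only [mul_add, sum_add_distrib] at hpen
  simp only [zhat, sum_cost_flipAt_of_eq_zero c hj2', sum_cost_flipAt_of_eq_zero c hj1,
    sum_cost_flipAt_of_eq_zero c hj2, cover_flipAt_of_eq_zero S hj2',
    cover_flipAt_of_eq_zero S hj1, cover_flipAt_of_eq_zero S hj2, hfilter]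
  linarith
end

section
/- (Lemma 2) Suppose a GUB-feasible solution x ∈ {0,1}^n is locally optimal with respect to the 1-flip neighborhood NB_1(x) under the penalized objective ẑ(·,w), and let j1, j2 satisfy x_{j1} = 1, x_{j2} = 0, where either the block G_h containing j2 satisfies Σ_{j∈G_h} x_j < d_h or j1 and j2 belong to the same block. Then Δẑ_{j1,j2}(x,w) < 0 holds only if at least one of the following two conditions holds: (i) j1 and j2 belong to the same block G_h satisfying Σ_{j∈G_h} x_j = d_h; (ii) M_E(x) ∩ S_{j1} ∩ S_{j2} ≠ ∅. -/
open Finset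

/-- GUB feasibility: at most `d h` columns selected from each block `G h`. -/
def GUBfeasible {n k : ℕ} (G : Fin k → Finset (Fin n)) (d : Fin k → ℕ)
    (x : Fin n → ℕ) : Prop :=
  ∀ h, ∑ j ∈ G h, x j ≤ d h

/-- Flipping one coordinate changes a separable sum only in the corresponding term. -/
lemma sum_flipAt {n : ℕ} (f : Fin n → ℕ → ℝ) (x : Fin n → ℕ) (j : Fin n) :
    ∑ j', f j' (flipAt x j j') = ∑ j', f j' (x j') - f j (x j) + f j (1 - x j) := by
  rw [← Finset.add_sum_erase univ _ (mem_univ j),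
    ← Finset.add_sum_erase univ (fun j' => f j' (x j')) (mem_univ j)]
  have h : ∑ j' ∈ univ.erase j, f j' (flipAt x j j') = ∑ j' ∈ univ.erase j, f j' (x j') :=
    Finset.sum_congr rfl fun j' hj' => by simp [flipAt, Finset.ne_of_mem_erase hj']
  rw [h]
  simp only [flipAt, if_true]
  ring

lemma cover_flipAt {m n : ℕ} (S : Fin n → Finset (Fin m)) (x : Fin n → ℕ) (j : Fin n)
    (i : Fin m) :
    (cover S (flipAt x j) i : ℝ) =
      cover S x i + if i ∈ S j then ((1 - x j : ℕ) : ℝ) - x j else 0 := by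
  have h := sum_flipAt (fun j' t => if i ∈ S j' then (t : ℝ) else 0) x j
  simp only [cover, Nat.cast_sum, Nat.cast_ite, Nat.cast_zero]
  rw [h]
  split_ifs <;> ring

/-- If no tight element is covered by both columns, the gain of dropping `j1` and adding `j2`
is at least the sum of the two separate gains. -/
lemma zhat_flipAt_add_le {m n : ℕ} (c : Fin n → ℝ) (S : Fin n → Finset (Fin m))
    (b : Fin m → ℕ) (w : Fin m → ℝ) (hw : ∀ i, 0 ≤ w i) (x : Fin n → ℕ) (j1 j2 : Fin n)
    (hj1 : x j1 = 1) (hj2 : x j2 = 0)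
    (htight : ∀ i, i ∈ S j1 → i ∈ S j2 → cover S x i ≠ b i) :
    zhat c S b w (flipAt x j1) + zhat c S b w (flipAt x j2) ≤
      zhat c S b w (flipAt (flipAt x j1) j2) + zhat c S b w x := by
  have hne : j2 ≠ j1 := by rintro rfl; omega
  have hflip : flipAt x j1 j2 = 0 := by simp [flipAt, hne, hj2]
  have hcost : ∑ j, c j * (flipAt x j1 j : ℝ) + ∑ j, c j * (flipAt x j2 j : ℝ) =
      ∑ j, c j * (flipAt (flipAt x j1) j2 j : ℝ) + ∑ j, c j * (x j : ℝ) := by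
    rw [sum_flipAt (fun j t => c j * (t : ℝ)) (flipAt x j1),
      sum_flipAt (fun j t => c j * (t : ℝ)) x j1, sum_flipAt (fun j t => c j * (t : ℝ)) x j2,
      hflip, hj2]
    ring
  have hpen : ∑ i, w i * max ((b i : ℝ) - (cover S (flipAt x j1) i : ℝ)) 0 +
      ∑ i, w i * max ((b i : ℝ) - (cover S (flipAt x j2) i : ℝ)) 0 ≤
      ∑ i, w i * max ((b i : ℝ) - (cover S (flipAt (flipAt x j1) j2) i : ℝ)) 0 +
      ∑ i, w i * max ((b i : ℝ) - (cover S x i : ℝ)) 0 := by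
    rw [← Finset.sum_add_distrib, ← Finset.sum_add_distrib]
    refine Finset.sum_le_sum fun i _ => ?_
    rw [← mul_add, ← mul_add]
    refine mul_le_mul_of_nonneg_left ?_ (hw i)
    rw [cover_flipAt S (flipAt x j1), cover_flipAt S x j1, cover_flipAt S x j2, hflip, hj1, hj2]
    by_cases h1 : i ∈ S j1 <;> by_cases h2 : i ∈ S j2 <;> simp [h1, h2, add_comm]
    rcases lt_or_gt_of_ne (htight i h1 h2) with h | h
    · have h' : (cover S x i : ℝ) + 1 ≤ b i := by exact_mod_cast h
      rw [max_eq_left (by linarith), max_eq_left (by linarith), max_eq_left (by linarith)]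
      linarith
    · have h' : (b i : ℝ) + 1 ≤ cover S x i := by exact_mod_cast h
      rw [max_eq_right (by linarith), max_eq_right (by linarith), max_eq_right (by linarith)]
  unfold zhat
  linarith

/-- Lemma 2: suppose `x` is a GUB-feasible 0-1 solution that is
locally optimal with respect to the 1-flip neighborhood under `ẑ(·,w)`,
and `x_{j1} = 1`, `x_{j2} = 0`, where either the block containing `j2` is not
saturated or `j1` and `j2` are in the same block.  Then the double flip
`x_{j1} = 1 → 0`, `x_{j2} = 0 → 1` improves (`Δẑ_{j1,j2}(x,w) < 0`) only if
(i) `j1` and `j2` belong to the same saturated block, or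
(ii) `M_E(x) ∩ S_{j1} ∩ S_{j2} ≠ ∅`. -/
theorem lemma2_two_flip_conditions {m n k : ℕ}
    (c : Fin n → ℝ) (S : Fin n → Finset (Fin m)) (b : Fin m → ℕ)
    (G : Fin k → Finset (Fin n)) (d : Fin k → ℕ) (w : Fin m → ℝ)
    (hc : ∀ j, 0 < c j) (hw : ∀ i, 0 ≤ w i)
    (hpart : ∀ j : Fin n, ∃! h, j ∈ G h) (hdG : ∀ h, d h ≤ (G h).card)
    (x : Fin n → ℕ) (hx : ∀ j, x j ≤ 1) (hfeas : GUBfeasible G d x)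
    (hup : ∀ j h, x j = 0 → j ∈ G h → (∑ j' ∈ G h, x j') < d h →
      0 ≤ zhat c S b w (flipAt x j) - zhat c S b w x)
    (hdown : ∀ j, x j = 1 →
      0 ≤ zhat c S b w (flipAt x j) - zhat c S b w x)
    (j1 j2 : Fin n) (hj1 : x j1 = 1) (hj2 : x j2 = 0)
    (hblk : (∃ h, j2 ∈ G h ∧ (∑ j ∈ G h, x j) < d h) ∨ (∃ h, j1 ∈ G h ∧ j2 ∈ G h))
    (himp : zhat c S b w (flipAt (flipAt x j1) j2) - zhat c S b w x < 0) :
    (∃ h, j1 ∈ G h ∧ j2 ∈ G h ∧ (∑ j ∈ G h, x j) = d h) ∨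
      ((S j1 ∩ S j2).filter (fun i => cover S x i = b i)).Nonempty := by
  by_contra! hcon
  obtain ⟨hblock, hempty⟩ := hcon
  have hroom : ∃ h, j2 ∈ G h ∧ (∑ j ∈ G h, x j) < d h := by
    rcases hblk with h | ⟨h, h1, h2⟩
    · exact h
    · exact ⟨h, h2, lt_of_le_of_ne (hfeas h) (hblock h h1 h2)⟩
  obtain ⟨h, h2, hlt⟩ := hroom
  have hadd := zhat_flipAt_add_le c S b w hw x j1 j2 hj1 hj2 fun i hi1 hi2 =>
    Finset.filter_eq_empty_iff.mp hempty (Finset.mem_inter.mpr ⟨hi1, hi2⟩)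
  linarith [hup j2 h hj2 h2 hlt, hdown j1 hj1]
end
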